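/- (Moving an entry of a shared box to a new box) Let λ ⊆ ν be partitions and let T be a set-valued tableau of shape ν/λ having at least one shared box (a box whose set has at least two elements). Suppose v is a finite sequence of positive integers such that the concatenation w(T)∘v is a reverse lattice word. Then there exist a partition ρ obtained from ν by adding a single box (ν ⊆ ρ and |ρ| = |ν| + 1) and a set-valued tableau T̃₁ of shape ρ/λ such that w(T̃₁)∘v is a reverse lattice word and the content of w(T̃₁) equals the content of w(T). -/

import Mathlib

open MvPolynomial

/-- A set-valued tableau on an arbitrary finite set of boxes `(row, column)`.
Entries are `0`-based: the entry `i : ℕ` stands for the integer `i + 1`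
(equivalently, for the variable `x_{i+1}`).  Rows weakly increase from left to
right and columns strictly increase from top to bottom, expressed via
horizontally and vertically adjacent boxes. -/
structure SVT (cells : Finset (ℕ × ℕ)) where
  entry : ℕ × ℕ → Finset ℕ
  nonempty_of_mem : ∀ c ∈ cells, (entry c).Nonempty
  eq_empty_of_not_mem : ∀ c, c ∉ cells → entry c = ∅
  row_weak : ∀ i j, (i, j) ∈ cells → (i, j + 1) ∈ cells →
    ∀ a ∈ entry (i, j), ∀ b ∈ entry (i, j + 1), a ≤ b
  col_strict : ∀ i j, (i, j) ∈ cells → (i + 1, j) ∈ cells →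
    ∀ a ∈ entry (i, j), ∀ b ∈ entry (i + 1, j), a < b

namespace SVT

variable {cells : Finset (ℕ × ℕ)}

/-- `|T|`: the total number of integers in the boxes of `T`. -/
def size (T : SVT cells) : ℕ := ∑ c ∈ cells, (T.entry c).card

/-- `T` has all its entries among `{1, …, m}` (i.e. `0`-based entries `< m`). -/
def Bounded (T : SVT cells) (m : ℕ) : Prop := ∀ c, ∀ x ∈ T.entry c, x < m

/-- The monomial `x^T`, where the exponent of the variable `i` is the number of
boxes of `T` containing `i`. -/
noncomputable def monomial (T : SVT cells) : MvPolynomial ℕ ℤ :=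
  ∏ c ∈ cells, ∏ i ∈ T.entry c, X i

/-- The column word of `T`: columns are read from left to right, each column
from bottom to top, the integers within a box in increasing order. -/
def word (T : SVT cells) : List ℕ :=
  (List.range ((cells.sup fun c => max c.1 c.2) + 1)).flatMap fun j =>
    ((List.range ((cells.sup fun c => max c.1 c.2) + 1)).reverse).flatMap fun i =>
      (T.entry (i, j)).sort (· ≤ ·)

end SVT

/-- The stable Grothendieck polynomial of the shape given by `cells`, in the
variables `x_1, …, x_m` (`0`-based: variables `0, …, m-1`):
`G(cells) = ∑_T (-1)^(|T| - #cells) x^T` over set-valued tableaux `T` of shape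
`cells` with entries in `{1, …, m}`. -/
noncomputable def grothendieck (cells : Finset (ℕ × ℕ)) (m : ℕ) : MvPolynomial ℕ ℤ :=
  ∑ᶠ (T : SVT cells) (_ : T.Bounded m), ((-1 : ℤ) ^ (T.size - cells.card)) • T.monomial

/-- A reverse lattice word: every suffix contains, for each `i`, at least as
many occurrences of `i` as of `i + 1`. -/
def IsRLW (w : List ℕ) : Prop := ∀ s, s <:+ w → ∀ i, s.count (i + 1) ≤ s.count i

/-- A partial reverse lattice word with respect to the (`0`-based, half-open)
interval `[a, b)`:  every suffix contains, for each `t` with `a ≤ t` and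
`t + 1 < b`, at least as many occurrences of `t` as of `t + 1`. -/
def IsPartialRLW (a b : ℕ) (w : List ℕ) : Prop :=
  ∀ s, s <:+ w → ∀ t, a ≤ t → t + 1 < b → s.count (t + 1) ≤ s.count t

/-- `w` has content `ν`: the number of occurrences of `i` in `w` is the length
of the `i`-th row of `ν`. -/
def HasContent (w : List ℕ) (nu : YoungDiagram) : Prop := ∀ i, w.count i = nu.rowLen i

/-- The cells of the skew diagram `λ * μ`, obtained by placing `λ` and `μ`
corner to corner: `λ` occupies rows `0, …, ℓ(λ)-1` shifted right by `μ₁`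
columns, and `μ` occupies the rows below row `ℓ(λ)-1`. -/
def starCells (lam mu : YoungDiagram) : Finset (ℕ × ℕ) :=
  (lam.cells.image fun c => (c.1, c.2 + mu.rowLen 0)) ∪
    (mu.cells.image fun c => (c.1 + lam.colLen 0, c.2))

/-- The structure constant `c^ν_{λμ}`: `(-1)^(|ν|-|λ|-|μ|)` times the number of
set-valued tableaux of shape `λ * μ` whose word is a reverse lattice word with
content `ν`. -/
noncomputable def cLR (lam mu nu : YoungDiagram) : ℤ :=
  (-1 : ℤ) ^ (nu.card - lam.card - mu.card) *
    (Nat.card {T : SVT (starCells lam mu) // IsRLW T.word ∧ HasContent T.word nu} : ℤ)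

/-- The coproduct structure constant `d^ν_{λμ}`: `(-1)^(|λ|+|μ|-|ν|)` times the
number of set-valued tableaux of shape `ν` whose word is a partial reverse
lattice word with respect to both intervals `[1, ℓ(λ)]` and
`[ℓ(λ)+1, ℓ(λ)+ℓ(μ)]` and has content `(λ₁, …, λ_{ℓ(λ)}, μ₁, …, μ_{ℓ(μ)})`. -/
noncomputable def dCoeff (lam mu nu : YoungDiagram) : ℤ :=
  (-1 : ℤ) ^ (lam.card + mu.card - nu.card) *
    (Nat.card {T : SVT nu.cells //
      IsPartialRLW 0 (lam.colLen 0) T.word ∧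
      IsPartialRLW (lam.colLen 0) (lam.colLen 0 + mu.colLen 0) T.word ∧
      ∀ i, T.word.count i =
        if i < lam.colLen 0 then lam.rowLen i else mu.rowLen (i - lam.colLen 0)} : ℤ)

/-- The coefficient `α_{θ,μ}` for a shape `θ` given by `cells`:
`(-1)^(|μ|-|θ|)` times the number of set-valued tableaux of shape `θ` whose
word is a reverse lattice word with content `μ`. -/
noncomputable def alphaCoeff (cells : Finset (ℕ × ℕ)) (mu : YoungDiagram) : ℤ :=
  (-1 : ℤ) ^ (mu.card - cells.card) *
    (Nat.card {T : SVT cells // IsRLW T.word ∧ HasContent T.word mu} : ℤ)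

/-- `ν/λ` is a vertical strip: at most one box in each row. -/
def IsVerticalStrip (lam nu : YoungDiagram) : Prop := ∀ i, nu.rowLen i ≤ lam.rowLen i + 1

/-- `ν/λ` is a horizontal strip: at most one box in each column. -/
def IsHorizontalStrip (lam nu : YoungDiagram) : Prop := ∀ j, nu.colLen j ≤ lam.colLen j + 1

/-- A set of boxes is a rook strip if it has at most one box in each row and in
each column. -/
def IsRookStripCells (s : Finset (ℕ × ℕ)) : Prop :=
  (∀ i, (s.filter fun c => c.1 = i).card ≤ 1) ∧ (∀ j, (s.filter fun c => c.2 = j).card ≤ 1)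

/-- The rectangular Young diagram with `p` rows and `q` columns. -/
def rect (p q : ℕ) : YoungDiagram :=
  ⟨Finset.range p ×ˢ Finset.range q, by
    intro a b hba ha
    simp only [Finset.coe_product, Set.mem_prod, Finset.mem_coe, Finset.mem_range] at ha ⊢
    exact ⟨lt_of_le_of_lt hba.1 ha.1, lt_of_le_of_lt hba.2 ha.2⟩⟩

/-- The box `c` precedes the box `p` when a column word is read from right to left. -/
def ReadBefore (c p : ℕ × ℕ) : Prop := p.2 < c.2 ∨ c.2 = p.2 ∧ c.1 < p.1

instance (c p : ℕ × ℕ) : Decidable (ReadBefore c p) := by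
  unfold ReadBefore; infer_instance

theorem ReadBefore.irrefl (c : ℕ × ℕ) : ¬ ReadBefore c c := by
  simp [ReadBefore]

theorem ReadBefore.trans {a b c : ℕ × ℕ} (h₁ : ReadBefore a b) (h₂ : ReadBefore b c) :
    ReadBefore a c := by
  simp only [ReadBefore] at *; omega

theorem ReadBefore.asymm {a b : ℕ × ℕ} (h : ReadBefore a b) : ¬ ReadBefore b a :=
  fun h' => ReadBefore.irrefl a (h.trans h')

theorem ReadBefore.trichotomy (a b : ℕ × ℕ) : ReadBefore a b ∨ a = b ∨ ReadBefore b a := by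
  simp only [ReadBefore, Prod.ext_iff]; omega

/-- The number of boxes of `S` read before `p` whose entry contains `t`. -/
def countBefore (S : Finset (ℕ × ℕ)) (E : ℕ × ℕ → Finset ℕ) (p : ℕ × ℕ) (t : ℕ) : ℕ :=
  (S.filter fun c => ReadBefore c p ∧ t ∈ E c).card

theorem countBefore_congr_support {S S' : Finset (ℕ × ℕ)} {E : ℕ × ℕ → Finset ℕ}
    (hS : S ⊆ S') (hE : ∀ c t, t ∈ E c → c ∈ S) (p : ℕ × ℕ) (t : ℕ) :
    countBefore S' E p t = countBefore S E p t := by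
  unfold countBefore
  congr 1
  ext c
  simp only [Finset.mem_filter]
  exact ⟨fun h => ⟨hE c t h.2.2, h.2⟩, fun h => ⟨hS h.1, h.2⟩⟩

theorem isRLW_cons {a : ℕ} {w : List ℕ} :
    IsRLW (a :: w) ↔ IsRLW w ∧ ∀ t, (a :: w).count (t + 1) ≤ (a :: w).count t := by
  constructor
  · exact fun h => ⟨fun s hs => h s (hs.trans (List.suffix_cons a w)), h _ List.suffix_rfl⟩
  · rintro ⟨h₁, h₂⟩ s hs
    rcases List.suffix_cons_iff.1 hs with rfl | hs
    · exact h₂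
    · exact h₁ s hs

theorem isRLW_sorted_append {l : List ℕ} (hl : l.Pairwise (· < ·)) (w : List ℕ) :
    IsRLW (l ++ w) ↔ IsRLW w ∧ ∀ t, t + 1 ∈ l → w.count (t + 1) + 1 ≤ w.count t := by
  induction l with
  | nil => simp
  | cons a l ih =>
    rw [List.pairwise_cons] at hl
    have nd : l.Nodup := hl.2.imp fun h => h.ne
    have cnt : ∀ s, l.count s = if s ∈ l then 1 else 0 := fun s => nd.count
    rw [List.cons_append, isRLW_cons, ih hl.2]
    simp only [List.count_cons, List.count_append, cnt, beq_iff_eq, List.mem_cons]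
    constructor
    · rintro ⟨⟨h₁, h₂⟩, h₃⟩
      refine ⟨h₁, fun t ht => ?_⟩
      by_cases hta : t + 1 ∈ l
      · exact h₂ t hta
      · have hta' : t + 1 = a := by tauto
        have : t ∉ l := fun h => by have := hl.1 t h; omega
        have : a ≠ t := by omega
        have := h₃ t
        simp_all
    · rintro ⟨h₁, h₂⟩
      refine ⟨⟨h₁, fun t ht => h₂ t (Or.inr ht)⟩, fun t => ?_⟩
      have h₄ := h₁ w List.suffix_rfl t
      have h₅ := h₂ t
      by_cases h₆ : t + 1 = a
      · have : t + 1 ∉ l := fun h => by have := hl.1 _ h; omega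
        have := h₅ (Or.inl h₆)
        split_ifs <;> omega
      · by_cases h₇ : t + 1 ∈ l
        · have := h₅ (Or.inr h₇)
          split_ifs <;> omega
        · split_ifs <;> omega

theorem count_flatMap_sort (E : ℕ × ℕ → Finset ℕ) {L : List (ℕ × ℕ)} (hL : L.Nodup) (t : ℕ) :
    (L.flatMap fun c => (E c).sort (· ≤ ·)).count t =
      (L.toFinset.filter fun c => t ∈ E c).card := by
  induction L with
  | nil => simp
  | cons a L ih =>
    rw [List.nodup_cons] at hL
    have : ((E a).sort (· ≤ ·)).count t = if t ∈ E a then 1 else 0 := by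
      rw [(Finset.sort_nodup _ _).count]; simp
    rw [List.flatMap_cons, List.count_append, ih hL.2, this, List.toFinset_cons,
      Finset.filter_insert]
    split_ifs with h
    · rw [Finset.card_insert_of_notMem (by simp [hL.1]), add_comm]
    · simp

theorem isRLW_flatMap_sort_append (E : ℕ × ℕ → Finset ℕ) {L : List (ℕ × ℕ)}
    (hL : L.Pairwise fun a b => ReadBefore b a) (v : List ℕ) :
    IsRLW ((L.flatMap fun c => (E c).sort (· ≤ ·)) ++ v) ↔
      IsRLW v ∧ ∀ p ∈ L, ∀ t, t + 1 ∈ E p →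
        v.count (t + 1) + countBefore L.toFinset E p (t + 1) + 1 ≤
          v.count t + countBefore L.toFinset E p t := by
  induction L with
  | nil => simp
  | cons a L ih =>
    rw [List.pairwise_cons] at hL
    have nd : L.Nodup := hL.2.imp fun {x y} h => by
      rintro rfl
      exact ReadBefore.irrefl _ h
    have hself : ∀ t, countBefore (a :: L).toFinset E a t =
        (L.flatMap fun c => (E c).sort (· ≤ ·)).count t := fun t => by
      rw [count_flatMap_sort E nd, countBefore]
      congr 1
      ext c
      simp only [List.toFinset_cons, Finset.mem_filter, Finset.mem_insert, List.mem_toFinset]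
      have := ReadBefore.irrefl a
      have := hL.1 c
      grind
    have hother : ∀ p ∈ L, ∀ t, countBefore (a :: L).toFinset E p t =
        countBefore L.toFinset E p t := fun p hp t => by
      rw [countBefore, List.toFinset_cons, Finset.filter_insert,
        if_neg fun h => (hL.1 p hp).asymm h.1, countBefore]
    rw [List.flatMap_cons, List.append_assoc,
      isRLW_sorted_append (Finset.sortedLT_sort (E a)).pairwise, ih hL.2]
    simp only [List.mem_cons, forall_eq_or_imp, hself, List.count_append, Finset.mem_sort,
      and_assoc]
    have : (∀ p ∈ L, ∀ t, t + 1 ∈ E p →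
        v.count (t + 1) + countBefore (a :: L).toFinset E p (t + 1) + 1 ≤ v.count t + countBefore (a :: L).toFinset E p t) ↔
        (∀ p ∈ L, ∀ t, t + 1 ∈ E p → v.count (t + 1) + countBefore L.toFinset E p (t + 1) + 1
        ≤ v.count t + countBefore L.toFinset E p t) := by
      refine forall₂_congr fun p hp => ?_
      simp only [hother p hp]
    rw [this]
    refine and_congr_right fun _ => ?_
    rw [and_comm]
    refine and_congr_left fun _ => forall₂_congr fun t _ => ?_
    omega

/-- The boxes of the `n × n` square in the order in which the column word visits them. -/
def columnOrder (n : ℕ) : List (ℕ × ℕ) :=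
  (List.range n).flatMap fun j => (List.range n).reverse.map fun i => (i, j)

theorem columnOrder_pairwise (n : ℕ) :
    (columnOrder n).Pairwise fun a b => ReadBefore b a := by
  rw [columnOrder, List.pairwise_flatMap]
  constructor
  · intro j _
    rw [List.pairwise_map, List.pairwise_reverse]
    exact List.pairwise_lt_range.imp fun h => Or.inr ⟨rfl, h⟩
  · refine List.pairwise_lt_range.imp fun {a b} h x hx y hy => ?_
    simp only [List.mem_map] at hx hy
    obtain ⟨_, _, rfl⟩ := hx
    obtain ⟨_, _, rfl⟩ := hy
    exact Or.inl h

theorem columnOrder_nodup (n : ℕ) : (columnOrder n).Nodup :=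
  (columnOrder_pairwise n).imp fun {x y} h => by
    rintro rfl
    exact ReadBefore.irrefl _ h

theorem mem_columnOrder {n : ℕ} {c : ℕ × ℕ} : c ∈ columnOrder n ↔ c.1 < n ∧ c.2 < n := by
  obtain ⟨i, j⟩ := c
  simp [columnOrder, and_comm]

namespace SVT

variable {cells : Finset (ℕ × ℕ)}

theorem mem_of_mem_entry (T : SVT cells) {c : ℕ × ℕ} {t : ℕ} (h : t ∈ T.entry c) : c ∈ cells := by
  by_contra hc
  simp [T.eq_empty_of_not_mem c hc] at h

theorem word_eq_flatMap_columnOrder (T : SVT cells) :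
    T.word = (columnOrder ((cells.sup fun c => max c.1 c.2) + 1)).flatMap
      fun c => (T.entry c).sort (· ≤ ·) := by
  simp only [word, columnOrder, List.flatMap_assoc, List.flatMap_map]

theorem subset_columnOrder (cells : Finset (ℕ × ℕ)) :
    cells ⊆ (columnOrder ((cells.sup fun c => max c.1 c.2) + 1)).toFinset := by
  intro c hc
  have := Finset.le_sup (f := fun c : ℕ × ℕ => max c.1 c.2) hc
  rw [List.mem_toFinset, mem_columnOrder]
  omega

theorem count_word (T : SVT cells) (t : ℕ) :
    T.word.count t = (cells.filter fun c => t ∈ T.entry c).card := by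
  rw [word_eq_flatMap_columnOrder, count_flatMap_sort _ (columnOrder_nodup _)]
  congr 1
  ext c
  simp only [Finset.mem_filter]
  exact ⟨fun h => ⟨T.mem_of_mem_entry h.2, h.2⟩, fun h => ⟨subset_columnOrder cells h.1, h.2⟩⟩

theorem isRLW_word_append (T : SVT cells) (v : List ℕ) :
    IsRLW (T.word ++ v) ↔ IsRLW v ∧ ∀ p t, t + 1 ∈ T.entry p →
      v.count (t + 1) + countBefore cells T.entry p (t + 1) + 1 ≤
        v.count t + countBefore cells T.entry p t := by
  rw [word_eq_flatMap_columnOrder, isRLW_flatMap_sort_append _ (columnOrder_pairwise _)]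
  simp only [countBefore_congr_support (subset_columnOrder cells)
    fun c t (h : t ∈ T.entry c) => T.mem_of_mem_entry h]
  refine and_congr_right fun _ => ⟨fun h p t ht => h p ?_ t ht, fun h p _ t ht => h p t ht⟩
  exact List.mem_toFinset.1 (subset_columnOrder cells (T.mem_of_mem_entry ht))

end SVT

/-- The lattice condition on the boxes of `S` followed by `v`, relaxed at the box `q`: there an
occurrence of `t + 1` with `t + 1 ∈ X` is allowed to be preceded by `t` from the same box. -/
def LatticeExcept (S : Finset (ℕ × ℕ)) (E : ℕ × ℕ → Finset ℕ) (v : List ℕ) (q : ℕ × ℕ)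
    (X : Finset ℕ) : Prop :=
  ∀ p t, t + 1 ∈ E p → v.count (t + 1) + countBefore S E p (t + 1) + 1 ≤
    v.count t + countBefore S E p t + if p = q ∧ t + 1 ∈ X ∧ t ∈ E p then 1 else 0

section Move

variable {S : Finset (ℕ × ℕ)} {E E' : ℕ × ℕ → Finset ℕ} {p₀ q : ℕ × ℕ} {y : ℕ}

theorem card_filter_move_add (hp₀ : p₀ ∈ S) (hq : q ∈ S) (hyp : y ∈ E p₀) (hyq : y ∉ E q)
    (hE' : ∀ c t, t ∈ E' c ↔ (t ∈ E c ∧ ¬ (c = p₀ ∧ t = y)) ∨ (c = q ∧ t = y))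
    (P : ℕ × ℕ → Prop) [DecidablePred P] :
    (S.filter fun c => P c ∧ y ∈ E' c).card + (if P p₀ then 1 else 0) =
      (S.filter fun c => P c ∧ y ∈ E c).card + (if P q then 1 else 0) := by
  have key : ∀ c₀ ∈ S, (if P c₀ then 1 else 0) = ∑ c ∈ S, if c = c₀ then
      (if P c₀ then 1 else 0) else 0 := fun c₀ h₀ => by
    rw [Finset.sum_ite_eq' S c₀, if_pos h₀]
  rw [key p₀ hp₀, key q hq, Finset.card_filter, Finset.card_filter, ← Finset.sum_add_distrib,
    ← Finset.sum_add_distrib]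
  refine Finset.sum_congr rfl fun c _ => ?_
  have hne : p₀ ≠ q := by rintro rfl; exact hyq hyp
  simp only [hE']
  by_cases h₁ : c = p₀
  · subst h₁
    simp [hyp, hne]
  · by_cases h₂ : c = q
    · subst h₂
      simp [hyq, h₁]
    · simp [h₁, h₂]

theorem card_filter_move_of_ne
    (hE' : ∀ c t, t ∈ E' c ↔ (t ∈ E c ∧ ¬ (c = p₀ ∧ t = y)) ∨ (c = q ∧ t = y))
    (P : ℕ × ℕ → Prop) [DecidablePred P] {t : ℕ} (ht : t ≠ y) :
    (S.filter fun c => P c ∧ t ∈ E' c).card = (S.filter fun c => P c ∧ t ∈ E c).card := by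
  simp [hE', ht]

theorem card_filter_move (hp₀ : p₀ ∈ S) (hq : q ∈ S) (hyp : y ∈ E p₀) (hyq : y ∉ E q)
    (hE' : ∀ c t, t ∈ E' c ↔ (t ∈ E c ∧ ¬ (c = p₀ ∧ t = y)) ∨ (c = q ∧ t = y)) (t : ℕ) :
    (S.filter fun c => t ∈ E' c).card = (S.filter fun c => t ∈ E c).card := by
  by_cases h : t = y
  · subst h
    simpa using card_filter_move_add hp₀ hq hyp hyq hE' fun _ => True
  · simpa using card_filter_move_of_ne (S := S) hE' (fun _ => True) h

theorem countBefore_add_le {p q : ℕ × ℕ} (hpS : p ∈ S) (hpq : ReadBefore p q) (t : ℕ) :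
    countBefore S E p t + (if t ∈ E p then 1 else 0) ≤ countBefore S E q t := by
  unfold countBefore
  split_ifs with h
  · rw [← Finset.card_insert_of_notMem (a := p) (by simp [ReadBefore.irrefl])]
    refine Finset.card_le_card fun c hc => ?_
    rcases Finset.mem_insert.1 hc with rfl | hc
    · simp [hpS, hpq, h]
    · rw [Finset.mem_filter] at hc ⊢
      exact ⟨hc.1, hc.2.1.trans hpq, hc.2.2⟩
  · refine Finset.card_le_card fun c hc => ?_
    rw [Finset.mem_filter] at hc ⊢
    exact ⟨hc.1, hc.2.1.trans hpq, hc.2.2⟩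

theorem countBefore_le_add {p q : ℕ × ℕ} {t : ℕ}
    (h : ∀ c, ReadBefore p c → ReadBefore c q → t ∉ E c) :
    countBefore S E q t ≤ countBefore S E p t + if t ∈ E p then 1 else 0 := by
  have hsub : (S.filter fun c => ReadBefore c q ∧ t ∈ E c) ⊆
      (S.filter fun c => ReadBefore c p ∧ t ∈ E c) ∪ (if t ∈ E p then {p} else ∅) := by
    intro c hc
    rw [Finset.mem_filter] at hc
    rcases ReadBefore.trichotomy c p with h₁ | rfl | h₁
    · simp [hc, h₁]
    · simp [hc.2.2]
    · exact absurd hc.2.2 (h c h₁ hc.2.1)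
  refine (Finset.card_le_card hsub).trans ((Finset.card_union_le _ _).trans ?_)
  unfold countBefore
  split_ifs <;> simp

theorem LatticeExcept.move {v : List ℕ} (hW : LatticeExcept S E v p₀ {y})
    (hS : ∀ c t, t ∈ E c → c ∈ S) (hq : q ∈ S) (hyp : y ∈ E p₀) (hyq : y ∉ E q)
    (hpq : ReadBefore p₀ q)
    (hE' : ∀ c t, t ∈ E' c ↔ (t ∈ E c ∧ ¬ (c = p₀ ∧ t = y)) ∨ (c = q ∧ t = y))
    (hbet : ∀ c, ReadBefore p₀ c → ReadBefore c q → y ∉ E c)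
    (hbet' : ∀ c, ReadBefore p₀ c → ReadBefore c q → y + 1 ∈ E c → y + 1 ∈ E q) :
    LatticeExcept S E' v q (E q) := by
  have hne : q ≠ p₀ := by rintro rfl; exact hyq hyp
  have hp₀ := hS _ _ hyp
  have eq_y : ∀ p, countBefore S E' p y + (if ReadBefore p₀ p then 1 else 0) =
      countBefore S E p y + (if ReadBefore q p then 1 else 0) := fun p =>
    card_filter_move_add hp₀ hq hyp hyq hE' fun c => ReadBefore c p
  have eq_ne : ∀ p t, t ≠ y → countBefore S E' p t = countBefore S E p t := fun p t ht =>
    card_filter_move_of_ne hE' (fun c => ReadBefore c p) ht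
  intro p t ht
  rcases (hE' p (t + 1)).1 ht with ⟨ht, hex⟩ | ⟨rfl, hty⟩
  · have hw := hW p t ht
    have hex' : ¬ (p = p₀ ∧ t + 1 ∈ ({y} : Finset ℕ) ∧ t ∈ E p) := by
      simp only [Finset.mem_singleton]; tauto
    rw [if_neg hex', add_zero] at hw
    by_cases h₁ : t + 1 = y
    · have h₂ := eq_y p
      rw [← h₁] at h₂
      rw [eq_ne p t (by omega)]
      by_cases h₃ : ReadBefore q p
      · rw [if_pos h₃, if_pos (hpq.trans h₃)] at h₂; omega
      · rw [if_neg h₃] at h₂; omega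
    · rw [eq_ne p (t + 1) h₁]
      by_cases h₂ : t = y
      · subst h₂
        have h₂ := eq_y p
        by_cases h₃ : ReadBefore q p
        · rw [if_pos h₃, if_pos (hpq.trans h₃)] at h₂; omega
        · by_cases h₄ : ReadBefore p₀ p
          · rw [if_neg h₃, if_pos h₄] at h₂
            rcases ReadBefore.trichotomy p q with h₅ | rfl | h₅
            · have h₆ := hW q t (hbet' p h₄ h₅ ht)
              rw [if_neg (by simp [hne])] at h₆
              have h₇ := countBefore_add_le (E := E) (hS _ _ ht) h₅ (t + 1)
              rw [if_pos ht] at h₇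
              have h₈ := countBefore_le_add (S := S) (E := E) (p := p) (q := q) (t := t)
                fun c hc => hbet c (h₄.trans hc)
              rw [if_neg (hbet p h₄ h₅)] at h₈
              omega
            · rw [if_pos ⟨rfl, ht, (hE' _ _).2 (Or.inr ⟨rfl, rfl⟩)⟩]
              omega
            · exact absurd h₅ h₃
          · rw [if_neg h₃, if_neg h₄] at h₂
            omega
      · rw [eq_ne p t h₂]; omega
  · have h₁ := eq_y p
    rw [if_pos hpq, if_neg (ReadBefore.irrefl p)] at h₁
    have h₂ := countBefore_le_add (S := S) hbet
    rw [if_pos hyp] at h₂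
    have h₃ := hW p₀ t (by rwa [hty])
    have h₄ := countBefore_add_le (E := E) hp₀ hpq t
    rw [eq_ne p t (by omega), hty]
    rw [hty] at h₃
    simp only [Finset.mem_singleton, true_and] at h₃
    omega

end Move

theorem YoungDiagram.mem_sdiff_of_between {lam nu : YoungDiagram} {i i' r j j' s : ℕ}
    (h₁ : (i, j) ∈ nu.cells \ lam.cells) (h₂ : (i', j') ∈ nu.cells \ lam.cells)
    (hi : i ≤ r) (hr : r ≤ i') (hj : j ≤ s) (hs : s ≤ j') :
    (r, s) ∈ nu.cells \ lam.cells := by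
  simp only [Finset.mem_sdiff, YoungDiagram.mem_cells] at *
  exact ⟨nu.up_left_mem hr hs h₂.1, fun h => h₁.2 (lam.up_left_mem hi hj h)⟩

namespace SVT

variable {lam nu : YoungDiagram}

theorem le_of_lt_of_mem_row (T : SVT (nu.cells \ lam.cells)) {i j j' a b : ℕ} (hj : j < j')
    (ha : a ∈ T.entry (i, j)) (hb : b ∈ T.entry (i, j')) : a ≤ b := by
  induction j', hj using Nat.le_induction generalizing b with
  | base => exact T.row_weak i j (T.mem_of_mem_entry ha) (T.mem_of_mem_entry hb) a ha b hb
  | succ j' hj ih =>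
    have hm := YoungDiagram.mem_sdiff_of_between (r := i) (s := j') (T.mem_of_mem_entry ha)
      (T.mem_of_mem_entry hb) le_rfl le_rfl (by omega) (by omega)
    obtain ⟨x, hx⟩ := T.nonempty_of_mem _ hm
    exact (ih hx).trans (T.row_weak i j' hm (T.mem_of_mem_entry hb) x hx b hb)

theorem lt_of_lt_of_mem_col (T : SVT (nu.cells \ lam.cells)) {i i' j a b : ℕ} (hi : i < i')
    (ha : a ∈ T.entry (i, j)) (hb : b ∈ T.entry (i', j)) : a < b := by
  induction i', hi using Nat.le_induction generalizing b with
  | base => exact T.col_strict i j (T.mem_of_mem_entry ha) (T.mem_of_mem_entry hb) a ha b hb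
  | succ i' hi ih =>
    have hm := YoungDiagram.mem_sdiff_of_between (r := i') (s := j) (T.mem_of_mem_entry ha)
      (T.mem_of_mem_entry hb) (by omega) (by omega) le_rfl le_rfl
    obtain ⟨x, hx⟩ := T.nonempty_of_mem _ hm
    exact (ih hx).trans (T.col_strict i' j hm (T.mem_of_mem_entry hb) x hx b hb)

theorem le_of_mem_of_lt_col (T : SVT (nu.cells \ lam.cells)) {i i' j j' a b : ℕ} (hi : i ≤ i')
    (hj : j < j') (ha : a ∈ T.entry (i, j)) (hb : b ∈ T.entry (i', j')) : a ≤ b := by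
  rcases hi.eq_or_lt with rfl | hi
  · exact T.le_of_lt_of_mem_row hj ha hb
  · have hm := YoungDiagram.mem_sdiff_of_between (r := i) (s := j') (T.mem_of_mem_entry ha)
      (T.mem_of_mem_entry hb) le_rfl hi.le hj.le le_rfl
    obtain ⟨x, hx⟩ := T.nonempty_of_mem _ hm
    exact (T.le_of_lt_of_mem_row hj ha hx).trans (T.lt_of_lt_of_mem_col hi hx hb).le

end SVT

/-- Move the entry `y` from the box `p` to the box `q`. -/
def moveEntry (E : ℕ × ℕ → Finset ℕ) (p q : ℕ × ℕ) (y : ℕ) (c : ℕ × ℕ) : Finset ℕ :=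
  if c = p then (E c).erase y else if c = q then insert y (E c) else E c

theorem mem_moveEntry {E : ℕ × ℕ → Finset ℕ} {p q : ℕ × ℕ} (hpq : p ≠ q) {y : ℕ} (c : ℕ × ℕ)
    (t : ℕ) : t ∈ moveEntry E p q y c ↔ (t ∈ E c ∧ ¬ (c = p ∧ t = y)) ∨ (c = q ∧ t = y) := by
  unfold moveEntry
  split_ifs with h₁ h₂
  · subst h₁; simp [hpq, and_comm]
  · subst h₂; simp [h₁, or_comm]
  · simp [h₁, h₂]

namespace SVT

variable {lam nu : YoungDiagram}

/-- Row insertion of the maximal entry `y` of the box `(i, j)` into the next row, in which the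
entry bumped by `y` is kept in its box together with `y`. -/
theorem exists_move_down (hle : lam ≤ nu) (T : SVT (nu.cells \ lam.cells)) {i j y : ℕ}
    (hy : y ∈ T.entry (i, j)) (hmax : ∀ a ∈ T.entry (i, j), a ≤ y)
    (hcard : 2 ≤ (T.entry (i, j)).card) {v : List ℕ}
    (hW : LatticeExcept (nu.cells \ lam.cells) T.entry v (i, j) {y})
    (hsing : ∀ c, i < c.1 → (T.entry c).card ≤ 1) :
    ∃ k, ∃ rho : YoungDiagram, rho.cells = insert (i + 1, k) nu.cells ∧
      (i + 1, k) ∉ lam.cells ∧ (∀ z ∈ T.entry (i + 1, k), y < z) ∧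
      ∃ T' : SVT (rho.cells \ lam.cells),
        T'.entry = moveEntry T.entry (i, j) (i + 1, k) y ∧
        LatticeExcept (rho.cells \ lam.cells) T'.entry v (i + 1, k) (T.entry (i + 1, k)) ∧
        ∀ t, T'.word.count t = T.word.count t := by
  classical
  have hp := T.mem_of_mem_entry hy
  obtain ⟨m, hm, hmy⟩ : ∃ m ∈ T.entry (i, j), m < y := by
    obtain ⟨m, hm, hne⟩ := Finset.exists_mem_ne (by omega : 1 < (T.entry (i, j)).card) y
    exact ⟨m, hm, lt_of_le_of_ne (hmax m hm) hne⟩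
  simp only [Finset.mem_sdiff, YoungDiagram.mem_cells] at hp
  have hjl : (i + 1, j) ∉ lam := fun h => hp.2 (lam.up_left_mem (by omega) le_rfl h)
  have hjn : (i + 1, j) ∈ nu → ∃ z ∈ T.entry (i + 1, j), y < z := fun h => by
    obtain ⟨z, hz⟩ := T.nonempty_of_mem (i + 1, j) (Finset.mem_sdiff.2 ⟨h, hjl⟩)
    exact ⟨z, hz, T.lt_of_lt_of_mem_col (Nat.lt_succ_self i) hy hz⟩
  have hex : ∃ k, (i + 1, k) ∉ lam ∧ ((i + 1, k) ∈ nu → ∃ z ∈ T.entry (i + 1, k), y < z) :=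
    ⟨j, hjl, hjn⟩
  obtain ⟨k, ⟨hkl, hkn⟩, hmin⟩ : ∃ k, ((i + 1, k) ∉ lam ∧
      ((i + 1, k) ∈ nu → ∃ z ∈ T.entry (i + 1, k), y < z)) ∧ ∀ k' < k, ¬ ((i + 1, k') ∉ lam ∧
      ((i + 1, k') ∈ nu → ∃ z ∈ T.entry (i + 1, k'), y < z)) :=
    ⟨Nat.find hex, Nat.find_spec hex, fun k' h => Nat.find_min hex h⟩
  have hkj : k ≤ j := not_lt.1 fun h => hmin j h ⟨hjl, hjn⟩
  have hleft : ∀ k' < k, ∀ a ∈ T.entry (i + 1, k'), a ≤ y := by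
    intro k' hk' a ha
    by_contra! hay
    have hc := T.mem_of_mem_entry ha
    simp only [Finset.mem_sdiff, YoungDiagram.mem_cells] at hc
    exact hmin k' hk' ⟨hc.2, fun _ => ⟨a, ha, hay⟩⟩
  have hq : ∀ z ∈ T.entry (i + 1, k), y < z := by
    intro z hz
    have hc := T.mem_of_mem_entry hz
    simp only [Finset.mem_sdiff, YoungDiagram.mem_cells] at hc
    obtain ⟨z', hz', hyz'⟩ := hkn hc.1
    rwa [Finset.card_le_one.1 (hsing (i + 1, k) (Nat.lt_succ_self i)) z hz z' hz']
  have hqne : ∀ c, c ∈ nu → i + 1 ≤ c.1 → k ≤ c.2 → ∃ z, z ∈ T.entry (i + 1, k) := by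
    intro c hc h₁ h₂
    obtain ⟨z, hz, -⟩ := hkn (nu.up_left_mem h₁ h₂ hc)
    exact ⟨z, hz⟩
  have hpq : ((i, j) : ℕ × ℕ) ≠ (i + 1, k) := by simp
  have hmem := fun c t => mem_moveEntry (E := T.entry) hpq (y := y) c t
  let rho : YoungDiagram := ⟨insert (i + 1, k) nu.cells, by
    intro a b hba ha
    simp only [Finset.coe_insert, Set.mem_insert_iff, Finset.mem_coe, YoungDiagram.mem_cells]
      at ha ⊢
    obtain ⟨b₁, b₂⟩ := b
    rcases ha with rfl | ha
    · obtain ⟨h₁, h₂⟩ : b₁ ≤ i + 1 ∧ b₂ ≤ k := hba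
      rcases h₁.eq_or_lt with rfl | h₁
      · rcases h₂.eq_or_lt with rfl | h₂
        · exact Or.inl rfl
        · refine Or.inr ?_
          by_contra hb
          exact hmin b₂ h₂ ⟨fun h => hb (hle h), fun h => absurd h hb⟩
      · exact Or.inr (nu.up_left_mem (by omega) (by omega) hp.1)
    · exact Or.inr (nu.up_left_mem hba.1 hba.2 ha)⟩
  have hrho : ∀ c, c ∈ rho.cells \ lam.cells ↔ c ∈ nu.cells \ lam.cells ∨ c = (i + 1, k) := by
    intro c
    simp only [rho, Finset.mem_sdiff, Finset.mem_insert, YoungDiagram.mem_cells]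
    constructor
    · tauto
    · rintro (h | rfl)
      · tauto
      · exact ⟨Or.inl rfl, hkl⟩
  have hsub : nu.cells \ lam.cells ⊆ rho.cells \ lam.cells := fun c hc => (hrho c).2 (Or.inl hc)
  have hqS : (i + 1, k) ∈ rho.cells \ lam.cells := (hrho _).2 (Or.inr rfl)
  have hES : ∀ c t, t ∈ T.entry c → c ∈ rho.cells \ lam.cells :=
    fun c t h => hsub (T.mem_of_mem_entry h)
  let T' : SVT (rho.cells \ lam.cells) :=
    { entry := moveEntry T.entry (i, j) (i + 1, k) y
      nonempty_of_mem := by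
        intro c hc
        by_cases h₁ : c = (i + 1, k)
        · exact ⟨y, (hmem c y).2 (Or.inr ⟨h₁, rfl⟩)⟩
        · by_cases h₂ : c = (i, j)
          · exact ⟨m, (hmem c m).2 (Or.inl ⟨h₂ ▸ hm, fun h => hmy.ne h.2⟩)⟩
          · obtain ⟨x, hx⟩ := T.nonempty_of_mem c (((hrho c).1 hc).resolve_right h₁)
            exact ⟨x, (hmem c x).2 (Or.inl ⟨hx, fun h => h₂ h.1⟩)⟩
      eq_empty_of_not_mem := by
        intro c hc
        refine Finset.eq_empty_of_forall_notMem fun t ht => ?_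
        rcases (hmem c t).1 ht with h | h
        · exact hc (hES c t h.1)
        · exact hc (h.1 ▸ hqS)
      row_weak := by
        intro r s _ _ a ha b hb
        rcases (hmem _ _).1 ha with ⟨ha₁, -⟩ | ⟨h₁, rfl⟩ <;>
          rcases (hmem _ _).1 hb with ⟨hb₁, -⟩ | ⟨h₂, rfl⟩
        · exact T.le_of_lt_of_mem_row (Nat.lt_succ_self s) ha₁ hb₁
        · simp only [Prod.mk.injEq] at h₂
          obtain ⟨rfl, rfl⟩ := h₂
          exact hleft s (Nat.lt_succ_self s) a ha₁
        · simp only [Prod.mk.injEq] at h₁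
          obtain ⟨rfl, rfl⟩ := h₁
          have hc := T.mem_of_mem_entry hb₁
          simp only [Finset.mem_sdiff, YoungDiagram.mem_cells] at hc
          obtain ⟨z, hz⟩ := hqne _ hc.1 le_rfl (Nat.le_succ s)
          exact (hq z hz).le.trans (T.le_of_lt_of_mem_row (Nat.lt_succ_self s) hz hb₁)
        · exact le_rfl
      col_strict := by
        intro r s _ _ a ha b hb
        rcases (hmem _ _).1 ha with ⟨ha₁, hane⟩ | ⟨h₁, rfl⟩ <;>
          rcases (hmem _ _).1 hb with ⟨hb₁, -⟩ | ⟨h₂, rfl⟩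
        · exact T.lt_of_lt_of_mem_col (Nat.lt_succ_self r) ha₁ hb₁
        · simp only [Prod.mk.injEq, add_left_inj] at h₂
          obtain ⟨rfl, rfl⟩ := h₂
          rcases hkj.eq_or_lt with rfl | hlt
          · exact lt_of_le_of_ne (hmax a ha₁) fun h => hane ⟨rfl, h⟩
          · exact (T.le_of_lt_of_mem_row hlt ha₁ hm).trans_lt hmy
        · simp only [Prod.mk.injEq] at h₁
          obtain ⟨rfl, rfl⟩ := h₁
          have hc := T.mem_of_mem_entry hb₁
          simp only [Finset.mem_sdiff, YoungDiagram.mem_cells] at hc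
          obtain ⟨z, hz⟩ := hqne _ hc.1 (Nat.le_succ _) le_rfl
          exact (hq z hz).trans (T.lt_of_lt_of_mem_col (Nat.lt_succ_self _) hz hb₁)
        · simp only [Prod.mk.injEq] at h₁ h₂
          omega }
  have hyq : y ∉ T.entry (i + 1, k) := fun h => (hq y h).false
  have hbet : ∀ c, ReadBefore (i, j) c → ReadBefore c (i + 1, k) → ∀ a ∈ T.entry c,
      a < y ∨ y < a ∧ (a = y + 1 → a ∈ T.entry (i + 1, k)) := by
    rintro ⟨r, s⟩ h₁ h₂ a ha
    simp only [ReadBefore] at h₁ h₂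
    by_cases hs : r ≤ i
    · exact Or.inl ((T.le_of_mem_of_lt_col hs (by omega) ha hm).trans_lt hmy)
    · have hc := T.mem_of_mem_entry ha
      simp only [Finset.mem_sdiff, YoungDiagram.mem_cells] at hc
      obtain ⟨z, hz⟩ := hqne _ hc.1 (by simp only; omega) (by simp only; omega)
      have hza := T.le_of_mem_of_lt_col (by omega) (by omega) hz ha
      have hyz := hq z hz
      refine Or.inr ⟨by omega, fun h => ?_⟩
      have : a = z := by omega
      rwa [this]
  have hW' : LatticeExcept (rho.cells \ lam.cells) T.entry v (i, j) {y} := by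
    intro p t ht
    simp only [countBefore_congr_support hsub fun c t (h : t ∈ T.entry c) => T.mem_of_mem_entry h]
    exact hW p t ht
  refine ⟨k, rho, rfl, hkl, hq, T', rfl, ?_, fun t => ?_⟩
  · refine hW'.move hES hqS hy hyq ?_ hmem ?_ ?_
    · simp only [ReadBefore]; omega
    · intro c h₁ h₂ h₃
      have := hbet c h₁ h₂ y h₃
      omega
    · intro c h₁ h₂ h₃
      rcases hbet c h₁ h₂ _ h₃ with h | h
      · omega
      · exact h.2 rfl
  · rw [count_word, count_word]
    refine (card_filter_move (hES _ _ hy) hqS hy hyq hmem t).trans ?_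
    congr 1
    ext c
    simp only [Finset.mem_filter]
    exact ⟨fun h => ⟨T.mem_of_mem_entry h.2, h.2⟩, fun h => ⟨hsub h.1, h.2⟩⟩

theorem exists_uncrowd (hle : lam ≤ nu) {v : List ℕ} (hv : IsRLW v) {n : ℕ}
    (hn : ∀ c ∈ nu.cells, c.1 < n) {i : ℕ} (hi : i ≤ n) (T : SVT (nu.cells \ lam.cells)) {j y : ℕ}
    (hy : y ∈ T.entry (i, j)) (hmax : ∀ a ∈ T.entry (i, j), a ≤ y)
    (hcard : 2 ≤ (T.entry (i, j)).card)
    (hW : LatticeExcept (nu.cells \ lam.cells) T.entry v (i, j) {y})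
    (hsing : ∀ c, i < c.1 → (T.entry c).card ≤ 1) :
    ∃ rho : YoungDiagram, nu ≤ rho ∧ rho.card = nu.card + 1 ∧
      ∃ T₁ : SVT (rho.cells \ lam.cells),
        IsRLW (T₁.word ++ v) ∧ ∀ t, T₁.word.count t = T.word.count t := by
  induction hi using Nat.decreasingInduction generalizing T j y with
  | self =>
    have hc := T.mem_of_mem_entry hy
    exact absurd (hn _ (Finset.mem_sdiff.1 hc).1) (lt_irrefl n)
  | of_succ i hi ih =>
    obtain ⟨k, rho, hrho, hkl, hq, T', hE, hL, hcount⟩ :=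
      T.exists_move_down hle hy hmax hcard hW hsing
    have hpq : ((i, j) : ℕ × ℕ) ≠ (i + 1, k) := by simp
    by_cases hkn : (i + 1, k) ∈ nu.cells
    · obtain rfl : rho = nu := YoungDiagram.ext (by rw [hrho, Finset.insert_eq_of_mem hkn])
      obtain ⟨z, hz⟩ := T.nonempty_of_mem (i + 1, k) (Finset.mem_sdiff.2 ⟨hkn, hkl⟩)
      have hEz : T.entry (i + 1, k) = {z} :=
        Finset.eq_singleton_iff_unique_mem.2 ⟨hz, fun x hx =>
          Finset.card_le_one.1 (hsing (i + 1, k) (Nat.lt_succ_self i)) x hx z hz⟩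
      have hyz := hq z hz
      have hE' : T'.entry (i + 1, k) = {y, z} := by
        rw [hE, moveEntry, if_neg hpq.symm, if_pos rfl, hEz]
      rw [hEz] at hL
      obtain ⟨ρ, h₁, h₂, T₁, h₃, h₄⟩ := ih T' (j := k) (y := z) (by simp [hE'])
        (by simp [hE', hyz.le]) (by rw [hE', Finset.card_pair hyz.ne]) hL (by
          rintro c hc
          have h₁ : c ≠ (i, j) := by rintro rfl; simp at hc
          have h₂ : c ≠ (i + 1, k) := by rintro rfl; exact lt_irrefl _ hc
          rw [hE, moveEntry, if_neg h₁, if_neg h₂]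
          exact hsing c (by omega))
      exact ⟨ρ, h₁, h₂, T₁, h₃, fun t => (h₄ t).trans (hcount t)⟩
    · refine ⟨rho, ?_, ?_, T', (T'.isRLW_word_append v).2 ⟨hv, fun p t ht => ?_⟩, hcount⟩
      · rw [← YoungDiagram.cells_subset_iff, hrho]
        exact Finset.subset_insert _ _
      · rw [YoungDiagram.card, hrho, Finset.card_insert_of_notMem hkn]
      · have := hL p t ht
        rwa [T.eq_empty_of_not_mem (i + 1, k) fun h => hkn (Finset.mem_sdiff.1 h).1,
          if_neg (by simp), add_zero] at this

end SVT

/-- **Moving an entry of a shared box to a new box** (Corollary 7.4): let `T`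
be a set-valued tableau of shape `ν/λ` with at least one shared box and `v` a
sequence such that `w(T) ∘ v` is a reverse lattice word.  Then there are a
partition `ρ` obtained from `ν` by adding one box and a tableau `T̃₁` of shape
`ρ/λ` with `w(T̃₁) ∘ v` a reverse lattice word and the content of `w(T̃₁)`
equal to that of `w(T)`. -/
theorem move_shared_entry_to_new_box (lam nu : YoungDiagram) (h : lam ≤ nu)
    (T : SVT (nu.cells \ lam.cells))
    (hshared : ∃ c ∈ nu.cells \ lam.cells, 2 ≤ (T.entry c).card)
    (v : List ℕ) (hv : IsRLW (T.word ++ v)) :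
    ∃ rho : YoungDiagram, nu ≤ rho ∧ rho.card = nu.card + 1 ∧
      ∃ T1 : SVT (rho.cells \ lam.cells),
        IsRLW (T1.word ++ v) ∧ ∀ i, T1.word.count i = T.word.count i := by
  obtain ⟨hv', hlat⟩ := (T.isRLW_word_append v).1 hv
  obtain ⟨⟨i, j⟩, hc, hmaxrow⟩ := ((nu.cells \ lam.cells).filter
    fun c => 2 ≤ (T.entry c).card).exists_max_image Prod.fst (by
      obtain ⟨c, hc, hc'⟩ := hshared
      exact ⟨c, Finset.mem_filter.2 ⟨hc, hc'⟩⟩)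
  obtain ⟨hc, hcard⟩ := Finset.mem_filter.1 hc
  have hne := T.nonempty_of_mem _ hc
  refine SVT.exists_uncrowd h hv' (n := nu.cells.sup Prod.fst + 1)
    (fun c hc => Nat.lt_succ_of_le (Finset.le_sup (f := Prod.fst) hc)) (i := i)
    (Nat.le_succ_of_le (Finset.le_sup (f := Prod.fst) (Finset.mem_sdiff.1 hc).1)) T
    (Finset.max'_mem _ hne) (fun a ha => Finset.le_max' _ a ha) hcard
    (fun p t ht => (hlat p t ht).trans (Nat.le_add_right _ _)) fun c hic => ?_
  by_contra! hcc
  have hcS : c ∈ nu.cells \ lam.cells := by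
    obtain ⟨x, hx⟩ := Finset.card_pos.1 (by omega : 0 < (T.entry c).card)
    exact T.mem_of_mem_entry hx
  have := hmaxrow c (Finset.mem_filter.2 ⟨hcS, hcc⟩)
  simp only at this
  omega
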